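/- arXiv:2309.08870 — 15 statements merged into one kernel-verified Lean document; each statement's English description precedes it below -/
import Mathlib

section
/- Let a, c > 0 be real numbers and for k ∈ ℝ set z(k) = (c − a·k²) + i·k ∈ ℂ, and let f(k) = Re √(z(k)). Then: the infimum of the set {f(k) : k ∈ ℝ} equals √c if 4ac ≤ 1 and equals 1/(2√a) if 4ac > 1; the supremum of {f(k) : k ∈ ℝ} equals 1/(2√a) if 4ac < 1 and equals √c if 4ac ≥ 1. Moreover f(0) = √c and f(k) → 1/(2√a) as |k| → ∞. -/
/-- The square of the real part of the principal square root of `x + i y`. -/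
noncomputable def sqrtReSq (x y : ℝ) : ℝ := (√(x ^ 2 + y ^ 2) + x) / 2

lemma re_cpow_half_eq_sqrt (x y : ℝ) :
    (((x : ℂ) + Complex.I * (y : ℂ)) ^ ((1 : ℂ) / 2)).re = √(sqrtReSq x y) := by
  rw [one_div, Complex.cpow_inv_two_re, mul_comm, Complex.norm_add_mul_I]
  simp [sqrtReSq]

lemma sqrtReSq_quadratic (x y : ℝ) :
    4 * sqrtReSq x y * (sqrtReSq x y - x) = y ^ 2 := by
  have h := Real.sq_sqrt (by positivity : 0 ≤ x ^ 2 + y ^ 2)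
  unfold sqrtReSq
  linear_combination h

lemma sqrtReSq_pos {x y : ℝ} (h : y ≠ 0 ∨ 0 < x) : 0 < sqrtReSq x y := by
  have hlt : -x < √(x ^ 2 + y ^ 2) := by
    rcases h with hy | hx
    · exact (neg_le_abs x).trans_lt (by
        rw [← Real.sqrt_sq_eq_abs]
        exact Real.sqrt_lt_sqrt (sq_nonneg x) (lt_add_of_pos_right _ (by positivity)))
    · exact (neg_lt_zero.mpr hx).trans_le (Real.sqrt_nonneg _)
  unfold sqrtReSq
  linarith

lemma sqrtReSq_parabola_pos {a c : ℝ} (hc : 0 < c) (k : ℝ) :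
    0 < sqrtReSq (c - a * k ^ 2) k := by
  refine sqrtReSq_pos ?_
  rcases eq_or_ne k 0 with rfl | hk
  · right; simpa using hc
  · exact Or.inl hk

lemma sqrtReSq_parabola_eq (a c k : ℝ) :
    k ^ 2 * (1 - 4 * a * sqrtReSq (c - a * k ^ 2) k) =
      4 * sqrtReSq (c - a * k ^ 2) k * (sqrtReSq (c - a * k ^ 2) k - c) := by
  linear_combination -sqrtReSq_quadratic (c - a * k ^ 2) k

/-- On the parabola, the squared real part lies between `c` and `1 / (4 a)`. -/
lemma sqrtReSq_parabola_mem_uIcc {a c : ℝ} (ha : 0 < a) (hc : 0 < c) (k : ℝ) :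
    sqrtReSq (c - a * k ^ 2) k ∈ Set.uIcc c (1 / (4 * a)) := by
  have hS := sqrtReSq_parabola_pos (a := a) hc k
  have hE := sqrtReSq_parabola_eq a c k
  set S := sqrtReSq (c - a * k ^ 2) k
  have hk := sq_nonneg k
  rw [Set.mem_uIcc, le_div_iff₀ (by positivity), div_le_iff₀ (by positivity)]
  rcases lt_trichotomy S c with h | h | h
  · right
    refine ⟨?_, h.le⟩
    by_contra! h'
    nlinarith [mul_nonneg hk (by linarith : 0 ≤ 1 - 4 * a * S), mul_pos hS (sub_pos.mpr h)]
  · rcases le_total (S * (4 * a)) 1 with h' | h'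
    · exact Or.inl ⟨h.ge, h'⟩
    · exact Or.inr ⟨h', h.le⟩
  · left
    refine ⟨h.le, ?_⟩
    by_contra! h'
    nlinarith [mul_nonneg hk (by linarith : 0 ≤ 4 * a * S - 1), mul_pos hS (sub_pos.mpr h)]

lemma tendsto_sqrtReSq_parabola {a c : ℝ} (ha : 0 < a) (hc : 0 < c) :
    Filter.Tendsto (fun k : ℝ => sqrtReSq (c - a * k ^ 2) k) (Filter.cocompact ℝ)
      (nhds (1 / (4 * a))) := by
  set M := max c (1 / (4 * a))
  have hinv : Filter.Tendsto (fun k : ℝ => M ^ 2 / a * (k ^ 2)⁻¹) (Filter.cocompact ℝ)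
      (nhds 0) := by
    have h : Filter.Tendsto (fun k : ℝ => k ^ 2) (Filter.cocompact ℝ) Filter.atTop := by
      simpa only [Function.comp_def, Real.norm_eq_abs, sq_abs] using
        (Filter.tendsto_pow_atTop two_ne_zero).comp (tendsto_norm_cocompact_atTop (E := ℝ))
    simpa using h.inv_tendsto_atTop.const_mul (M ^ 2 / a)
  rw [tendsto_iff_dist_tendsto_zero]
  refine squeeze_zero' (Filter.Eventually.of_forall fun _ => dist_nonneg) ?_ hinv
  filter_upwards [(isCompact_singleton (x := (0 : ℝ))).compl_mem_cocompact] with k hk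
  have hk0 : k ≠ 0 := hk
  have hS := sqrtReSq_parabola_pos (a := a) hc k
  have hE := sqrtReSq_parabola_eq a c k
  have hSM : sqrtReSq (c - a * k ^ 2) k ≤ M := (sqrtReSq_parabola_mem_uIcc ha hc k).2
  have hcM : c ≤ M := le_max_left _ _
  set S := sqrtReSq (c - a * k ^ 2) k
  have hdiff : S - 1 / (4 * a) = -(S * (S - c)) / a * (k ^ 2)⁻¹ := by
    field_simp
    linear_combination -hE
  have habs : |S - c| ≤ M := abs_le.mpr ⟨by linarith, by linarith⟩
  rw [Real.dist_eq, hdiff, abs_mul, abs_div, abs_neg, abs_mul, abs_of_pos hS, abs_of_pos ha,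
    abs_of_nonneg (by positivity : 0 ≤ (k ^ 2)⁻¹), sq M]
  gcongr

/-- For `a, c > 0`, set `z(k) = (c − a k²) + i k` and
`f(k) = Re √(z(k))` (principal complex square root, realized as `z ^ (1/2)`).
Then `sInf (range f) = √c` if `4ac ≤ 1` and `= 1/(2√a)` if `4ac > 1`;
`sSup (range f) = 1/(2√a)` if `4ac < 1` and `= √c` if `4ac ≥ 1`;
moreover `f 0 = √c` and `f k → 1/(2√a)` as `|k| → ∞`. -/
theorem stmt_0 (a c : ℝ) (ha : 0 < a) (hc : 0 < c)
    (f : ℝ → ℝ)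
    (hf : ∀ k : ℝ, f k =
      ((((c - a * k ^ 2 : ℝ) : ℂ) + Complex.I * (k : ℂ)) ^ ((1 : ℂ) / 2)).re) :
    (4 * a * c ≤ 1 → sInf (Set.range f) = Real.sqrt c) ∧
    (1 < 4 * a * c → sInf (Set.range f) = 1 / (2 * Real.sqrt a)) ∧
    (4 * a * c < 1 → sSup (Set.range f) = 1 / (2 * Real.sqrt a)) ∧
    (1 ≤ 4 * a * c → sSup (Set.range f) = Real.sqrt c) ∧
    f 0 = Real.sqrt c ∧
    Filter.Tendsto f (Filter.cocompact ℝ) (nhds (1 / (2 * Real.sqrt a))) := by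
  have hlim : √(1 / (4 * a)) = 1 / (2 * √a) := by
    rw [Real.sqrt_div zero_le_one, Real.sqrt_one, Real.sqrt_mul (by norm_num),
      show (4 : ℝ) = 2 ^ 2 by norm_num, Real.sqrt_sq (by norm_num)]
  have hfS : f = fun k => √(sqrtReSq (c - a * k ^ 2) k) := by
    funext k
    rw [hf, re_cpow_half_eq_sqrt]
  have hf0 : f 0 = √c := by
    rw [hfS]
    simp [sqrtReSq, Real.sqrt_sq hc.le]
  have htend : Filter.Tendsto f (Filter.cocompact ℝ) (nhds (1 / (2 * √a))) := by
    rw [hfS, ← hlim]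
    exact (tendsto_sqrtReSq_parabola ha hc).sqrt
  have hlow : 4 * a * c ≤ 1 → ∀ k, √c ≤ f k ∧ f k ≤ 1 / (2 * √a) := by
    intro h k
    have hle : c ≤ 1 / (4 * a) := by
      rw [le_div_iff₀ (by positivity)]; linarith
    have hm := sqrtReSq_parabola_mem_uIcc ha hc k
    rw [Set.uIcc_of_le hle] at hm
    rw [hfS, ← hlim]
    exact ⟨Real.sqrt_le_sqrt hm.1, Real.sqrt_le_sqrt hm.2⟩
  have hhigh : 1 ≤ 4 * a * c → ∀ k, 1 / (2 * √a) ≤ f k ∧ f k ≤ √c := by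
    intro h k
    have hle : 1 / (4 * a) ≤ c := by
      rw [div_le_iff₀ (by positivity)]; linarith
    have hm := sqrtReSq_parabola_mem_uIcc ha hc k
    rw [Set.uIcc_of_ge hle] at hm
    rw [hfS, ← hlim]
    exact ⟨Real.sqrt_le_sqrt hm.1, Real.sqrt_le_sqrt hm.2⟩
  refine ⟨fun h => ?_, fun h => ?_, fun h => ?_, fun h => ?_, hf0, htend⟩
  · exact IsLeast.csInf_eq ⟨⟨0, hf0⟩, Set.forall_mem_range.mpr fun k => (hlow h k).1⟩
  · refine IsGLB.csInf_eq ⟨Set.forall_mem_range.mpr fun k => (hhigh h.le k).1, fun b hb => ?_⟩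
      (Set.range_nonempty f)
    exact ge_of_tendsto' htend fun k => hb ⟨k, rfl⟩
  · refine IsLUB.csSup_eq ⟨Set.forall_mem_range.mpr fun k => (hlow h.le k).2, fun b hb => ?_⟩
      (Set.range_nonempty f)
    exact le_of_tendsto' htend fun k => hb ⟨k, rfl⟩
  · exact IsGreatest.csSup_eq ⟨⟨0, hf0⟩, Set.forall_mem_range.mpr fun k => (hhigh h k).2⟩
end

section
/- Let ν > 1, let F > 2 be real, set F_char = (ν+1)/ν², and let c ≥ 0 be real and λ̃ ∈ ℂ with Re λ̃ ≥ 0. Then Re( F²·ν·λ̃ − √( c·(F_char² − F²) + F²·F_char²·ν²·λ̃² ) ) ≥ F·(F − F_char)·ν·Re λ̃ ≥ 0, where √· is the principal complex square root. -/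
/-- If `w ^ 2 = k + m ^ 2` with `k ≤ 0` real and `0 ≤ m.re`, then `w.re ≤ m.re`. -/
lemma Complex.re_le_re_of_sq_eq_add_sq {w m : ℂ} {k : ℝ} (hk : k ≤ 0) (hm : 0 ≤ m.re)
    (h : w ^ 2 = (k : ℂ) + m ^ 2) : w.re ≤ m.re := by
  by_contra! hlt
  have hre : w.re ^ 2 - w.im ^ 2 = k + (m.re ^ 2 - m.im ^ 2) := by
    have := congrArg Complex.re h
    simp [pow_two] at this
    linarith
  have him : w.re * w.im = m.re * m.im := by
    have := congrArg Complex.im h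
    simp [pow_two] at this
    linarith
  have hsq : m.re ^ 2 < w.re ^ 2 := by gcongr
  have hw : 0 < w.re ^ 2 := (sq_nonneg _).trans_lt hsq
  have hq : w.im ^ 2 ≤ m.im ^ 2 := by
    refine le_of_mul_le_mul_left ?_ hw
    calc w.re ^ 2 * w.im ^ 2 = m.re ^ 2 * m.im ^ 2 := by rw [← mul_pow, him, mul_pow]
      _ ≤ w.re ^ 2 * m.im ^ 2 := by gcongr
  linarith

/-- The principal square root of `k + m ^ 2` with `k ≤ 0` real has real part at most that of `m`,
when the latter is nonnegative. -/
lemma Complex.re_cpow_half_add_sq_le {m : ℂ} {k : ℝ} (hk : k ≤ 0) (hm : 0 ≤ m.re) :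
    (((k : ℂ) + m ^ 2) ^ ((1 : ℂ) / 2)).re ≤ m.re :=
  re_le_re_of_sq_eq_add_sq hk hm (by simp [one_div])


/-- For `ν > 1`, `F > 2`, `F_char = (ν+1)/ν²`, `c ≥ 0` real and
`λ̃ ∈ ℂ` with `Re λ̃ ≥ 0`, one has
`Re(F²ν λ̃ − √(c (F_char² − F²) + F² F_char² ν² λ̃²)) ≥ F (F − F_char) ν Re λ̃ ≥ 0`,
with `√·` the principal complex square root (realized as `z ^ (1/2)`). -/
theorem stmt_2 (ν F : ℝ) (hν : 1 < ν) (hF : 2 < F) (c : ℝ) (hc : 0 ≤ c)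
    (lam : ℂ) (hlam : 0 ≤ lam.re) :
    F * (F - (ν + 1) / ν ^ 2) * ν * lam.re ≤
      (((F ^ 2 * ν : ℝ) : ℂ) * lam -
        (((c * (((ν + 1) / ν ^ 2) ^ 2 - F ^ 2) : ℝ) : ℂ) +
          ((F ^ 2 * ((ν + 1) / ν ^ 2) ^ 2 * ν ^ 2 : ℝ) : ℂ) * lam ^ 2) ^ ((1 : ℂ) / 2)).re ∧
    0 ≤ F * (F - (ν + 1) / ν ^ 2) * ν * lam.re := by
  have hν0 : 0 < ν := by linarith
  have hpos : 0 < (ν + 1) / ν ^ 2 := by positivity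
  have hlt : (ν + 1) / ν ^ 2 < F := by
    refine lt_trans ?_ hF
    rw [div_lt_iff₀ (by positivity)]
    nlinarith
  generalize (ν + 1) / ν ^ 2 = G at hpos hlt ⊢
  have hF0 : 0 < F := hpos.trans hlt
  refine ⟨?_, mul_nonneg (by have := sub_pos.2 hlt; positivity) hlam⟩
  have hk : c * (G ^ 2 - F ^ 2) ≤ 0 :=
    mul_nonpos_of_nonneg_of_nonpos hc (sub_nonpos.2 (by gcongr))
  have hm : (((F * G * ν : ℝ) : ℂ) * lam).re = F * G * ν * lam.re := Complex.re_ofReal_mul _ _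
  have key := Complex.re_cpow_half_add_sq_le (m := ((F * G * ν : ℝ) : ℂ) * lam) hk
    (by rw [hm]; positivity)
  have hsq : ((F ^ 2 * G ^ 2 * ν ^ 2 : ℝ) : ℂ) * lam ^ 2 = (((F * G * ν : ℝ) : ℂ) * lam) ^ 2 := by
    push_cast
    ring
  rw [hm] at key
  rw [hsq, Complex.sub_re, Complex.re_ofReal_mul]
  linarith
end

section
/- Let ν > 1 and 0 < F ≤ 2 be real. For k ∈ ℝ define w(k) = √( F²ν⁴ − i·F²ν²·k − k² ) (principal complex square root) and λ₊(k) = −ν + i·k·ν/(ν+1) + w(k)/(Fν), λ₋(k) = −ν + i·k·ν/(ν+1) − w(k)/(Fν). Then: (i) Re λ₊(k) ≤ 0 for all k ∈ ℝ, with Re λ₊(0) = 0; (ii) if moreover F < 2, then Re λ₊(k) < 0 for every k ≠ 0; (iii) the supremum of the set {Re λ₋(k) : k ∈ ℝ} equals −ν·(1 + F/2). -/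
/-- The square `X` of the real part of a square root of `p + i q` is a root of
`4 X ^ 2 - 4 p X - q ^ 2`. -/
lemma re_sq_quadratic_of_sq_eq {w z : ℂ} (h : w ^ 2 = z) :
    4 * (w.re ^ 2) ^ 2 - 4 * z.re * w.re ^ 2 - z.im ^ 2 = 0 := by
  subst h
  simp only [pow_two, Complex.mul_re, Complex.mul_im]
  ring

lemma re_cpow_half_quadratic {z : ℂ} {a ν k : ℝ} (hre : z.re = a ^ 2 * ν ^ 2 - k ^ 2)
    (him : z.im = -(a ^ 2 * k)) :
    4 * ((z ^ ((1 : ℂ) / 2)).re ^ 2) ^ 2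
      - 4 * (a ^ 2 * ν ^ 2 - k ^ 2) * (z ^ ((1 : ℂ) / 2)).re ^ 2 - a ^ 4 * k ^ 2 = 0 := by
  have hsq : (z ^ ((1 : ℂ) / 2)) ^ 2 = z := by
    rw [one_div]
    exact Complex.cpow_ofNat_inv_pow z 2
  have h := re_sq_quadratic_of_sq_eq hsq
  rw [hre, him] at h
  linarith [h]

lemma re_cpow_half_pos {z : ℂ} {a ν k : ℝ} (ha : 0 < a) (hν : 0 < ν)
    (hre : z.re = a ^ 2 * ν ^ 2 - k ^ 2) (him : z.im = -(a ^ 2 * k)) :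
    0 < (z ^ ((1 : ℂ) / 2)).re := by
  rw [one_div, Complex.cpow_inv_two_re]
  apply Real.sqrt_pos.2
  rcases eq_or_ne k 0 with rfl | hk
  · have : 0 < z.re := by rw [hre]; simp; positivity
    positivity
  · have him' : z.im ≠ 0 := by rw [him]; exact neg_ne_zero.2 (by positivity)
    have := (abs_lt.1 (Complex.abs_re_lt_norm.2 him')).1
    linarith

/-- Comparison of the positive root `x ^ 2` of the quadratic with a trial value `T`. -/
lemma quadratic_factor_pos {x a ν k T : ℝ} (hx : 0 < x) (hT : 0 < T)
    (h : 4 * (x ^ 2) ^ 2 - 4 * (a ^ 2 * ν ^ 2 - k ^ 2) * x ^ 2 - a ^ 4 * k ^ 2 = 0) :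
    0 < x ^ 2 + T - (a ^ 2 * ν ^ 2 - k ^ 2) := by
  have h1 : 0 ≤ x ^ 2 * (x ^ 2 - (a ^ 2 * ν ^ 2 - k ^ 2)) := by
    have : 0 ≤ a ^ 4 * k ^ 2 := by positivity
    linarith
  have := nonneg_of_mul_nonneg_right h1 (by positivity)
  linarith

lemma quadratic_eval {x a ν k T : ℝ}
    (h : 4 * (x ^ 2) ^ 2 - 4 * (a ^ 2 * ν ^ 2 - k ^ 2) * x ^ 2 - a ^ 4 * k ^ 2 = 0) :
    4 * T ^ 2 - 4 * (a ^ 2 * ν ^ 2 - k ^ 2) * T - a ^ 4 * k ^ 2 =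
      4 * (T - x ^ 2) * (x ^ 2 + T - (a ^ 2 * ν ^ 2 - k ^ 2)) := by
  linear_combination h

lemma sq_le_of_quadratic_nonneg {x a ν k T : ℝ} (hx : 0 < x) (hT : 0 < T)
    (h : 4 * (x ^ 2) ^ 2 - 4 * (a ^ 2 * ν ^ 2 - k ^ 2) * x ^ 2 - a ^ 4 * k ^ 2 = 0)
    (hq : 0 ≤ 4 * T ^ 2 - 4 * (a ^ 2 * ν ^ 2 - k ^ 2) * T - a ^ 4 * k ^ 2) : x ^ 2 ≤ T := by
  rw [quadratic_eval h] at hq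
  have := nonneg_of_mul_nonneg_left hq (quadratic_factor_pos hx hT h)
  linarith

lemma sq_lt_of_quadratic_pos {x a ν k T : ℝ} (hx : 0 < x) (hT : 0 < T)
    (h : 4 * (x ^ 2) ^ 2 - 4 * (a ^ 2 * ν ^ 2 - k ^ 2) * x ^ 2 - a ^ 4 * k ^ 2 = 0)
    (hq : 0 < 4 * T ^ 2 - 4 * (a ^ 2 * ν ^ 2 - k ^ 2) * T - a ^ 4 * k ^ 2) : x ^ 2 < T := by
  rw [quadratic_eval h] at hq
  have := pos_of_mul_pos_left hq (quadratic_factor_pos hx hT h).le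
  linarith

lemma le_sq_of_quadratic_nonpos {x a ν k T : ℝ} (hx : 0 < x) (hT : 0 < T)
    (h : 4 * (x ^ 2) ^ 2 - 4 * (a ^ 2 * ν ^ 2 - k ^ 2) * x ^ 2 - a ^ 4 * k ^ 2 = 0)
    (hq : 4 * T ^ 2 - 4 * (a ^ 2 * ν ^ 2 - k ^ 2) * T - a ^ 4 * k ^ 2 ≤ 0) : T ≤ x ^ 2 := by
  rw [quadratic_eval h] at hq
  have := nonpos_of_mul_nonpos_left hq (quadratic_factor_pos hx hT h)
  linarith


/-- For `ν > 1` and `0 < F ≤ 2`, with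
`w(k) = √(F²ν⁴ − i F²ν² k − k²)` (principal complex square root) and
`λ₊(k) = −ν + i k ν/(ν+1) + w(k)/(Fν)`, `λ₋(k) = −ν + i k ν/(ν+1) − w(k)/(Fν)`:
(i) `Re λ₊(k) ≤ 0` for all `k`, with `Re λ₊(0) = 0`;
(ii) if `F < 2` then `Re λ₊(k) < 0` for every `k ≠ 0`;
(iii) `sSup {Re λ₋(k) : k ∈ ℝ} = −ν (1 + F/2)`. -/
theorem stmt_3 (ν F : ℝ) (hν : 1 < ν) (hF0 : 0 < F) (hF : F ≤ 2)
    (w : ℝ → ℂ)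
    (hw : ∀ k : ℝ, w k =
      (((F ^ 2 * ν ^ 4 : ℝ) : ℂ) - Complex.I * ((F ^ 2 * ν ^ 2 * k : ℝ) : ℂ) -
        ((k ^ 2 : ℝ) : ℂ)) ^ ((1 : ℂ) / 2))
    (lamP lamM : ℝ → ℂ)
    (hlamP : ∀ k : ℝ, lamP k =
      -(ν : ℂ) + Complex.I * ((k * ν / (ν + 1) : ℝ) : ℂ) + w k / ((F * ν : ℝ) : ℂ))
    (hlamM : ∀ k : ℝ, lamM k =
      -(ν : ℂ) + Complex.I * ((k * ν / (ν + 1) : ℝ) : ℂ) - w k / ((F * ν : ℝ) : ℂ)) :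
    (∀ k : ℝ, (lamP k).re ≤ 0) ∧ (lamP 0).re = 0 ∧
    (F < 2 → ∀ k : ℝ, k ≠ 0 → (lamP k).re < 0) ∧
    sSup (Set.range fun k : ℝ => (lamM k).re) = -ν * (1 + F / 2) := by
  have hν0 : 0 < ν := by linarith
  obtain ⟨a, ha⟩ : ∃ a, a = F * ν := ⟨_, rfl⟩
  have ha0 : 0 < a := ha ▸ mul_pos hF0 hν0
  have ha2 : a ≤ 2 * ν := ha ▸ mul_le_mul_of_nonneg_right hF hν0.le
  have hquad_pos : ∀ k, 0 < (w k).re ∧ 4 * ((w k).re ^ 2) ^ 2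
      - 4 * (a ^ 2 * ν ^ 2 - k ^ 2) * (w k).re ^ 2 - a ^ 4 * k ^ 2 = 0 := by
    intro k
    rw [hw k]
    set z : ℂ := ((F ^ 2 * ν ^ 4 : ℝ) : ℂ) - Complex.I * ((F ^ 2 * ν ^ 2 * k : ℝ) : ℂ) -
        ((k ^ 2 : ℝ) : ℂ) with hz
    have hre : z.re = a ^ 2 * ν ^ 2 - k ^ 2 := by
      simp only [hz, ha, Complex.sub_re, Complex.ofReal_re, Complex.re_mul_ofReal, Complex.I_re]
      ring
    have him : z.im = -(a ^ 2 * k) := by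
      simp only [hz, ha, Complex.sub_im, Complex.ofReal_im, Complex.im_mul_ofReal, Complex.I_im]
      ring
    exact ⟨re_cpow_half_pos ha0 hν0 hre him, re_cpow_half_quadratic hre him⟩
  have hPre : ∀ k, (lamP k).re = -ν + (w k).re / a := by
    intro k
    rw [hlamP k, ← ha]
    simp only [Complex.add_re, Complex.neg_re, Complex.ofReal_re, Complex.re_mul_ofReal,
      Complex.I_re, Complex.div_ofReal_re]
    ring
  have hMre : ∀ k, (lamM k).re = -ν - (w k).re / a := by
    intro k
    rw [hlamM k, ← ha]
    simp only [Complex.sub_re, Complex.add_re, Complex.neg_re, Complex.ofReal_re,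
      Complex.re_mul_ofReal, Complex.I_re, Complex.div_ofReal_re]
    ring
  have hevalT : ∀ k, 4 * (a ^ 2 * ν ^ 2) ^ 2 - 4 * (a ^ 2 * ν ^ 2 - k ^ 2) * (a ^ 2 * ν ^ 2)
      - a ^ 4 * k ^ 2 = (a * k) ^ 2 * ((2 * ν - a) * (2 * ν + a)) := fun k => by ring
  refine ⟨fun k => ?_, ?_, fun hF2 k hk => ?_, ?_⟩
  · obtain ⟨hx, hq⟩ := hquad_pos k
    have h := sq_le_of_quadratic_nonneg hx (by positivity : 0 < a ^ 2 * ν ^ 2) hq (by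
      rw [hevalT]
      have : 0 ≤ 2 * ν - a := by linarith
      positivity)
    rw [← mul_pow] at h
    have := (div_le_iff₀' ha0).2 (pow_le_pow_iff_left₀ hx.le (by positivity) two_ne_zero |>.1 h)
    rw [hPre]
    linarith
  · obtain ⟨hx, hq⟩ := hquad_pos 0
    have h : (w 0).re ^ 2 * ((w 0).re ^ 2 - (a * ν) ^ 2) = 0 := by linarith
    have h' := (mul_eq_zero.1 h).resolve_left (by positivity)
    have : (w 0).re = a * ν :=
      (pow_left_inj₀ hx.le (by positivity) two_ne_zero).1 (sub_eq_zero.1 h')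
    rw [hPre, this]
    field_simp
    ring
  · obtain ⟨hx, hq⟩ := hquad_pos k
    have ha2' : a < 2 * ν := ha ▸ mul_lt_mul_of_pos_right hF2 hν0
    have h := sq_lt_of_quadratic_pos hx (by positivity : 0 < a ^ 2 * ν ^ 2) hq (by
      rw [hevalT]
      have : 0 < 2 * ν - a := by linarith
      positivity)
    rw [← mul_pow] at h
    have := (div_lt_iff₀' ha0).2 (lt_of_pow_lt_pow_left₀ 2 (by positivity) h)
    rw [hPre]
    linarith
  · have hval : -ν * (1 + F / 2) = -ν - a / 2 := by rw [ha]; ring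
    rw [hval]
    apply csSup_eq_of_forall_le_of_forall_lt_exists_gt (Set.range_nonempty _)
    · rintro _ ⟨k, rfl⟩
      obtain ⟨hx, hq⟩ := hquad_pos k
      have h := le_sq_of_quadratic_nonpos hx (by positivity : 0 < (a ^ 2 / 2) ^ 2) hq (by
        have : 0 ≤ a ^ 6 / 4 * ((2 * ν - a) * (2 * ν + a)) := by
          have : 0 ≤ 2 * ν - a := by linarith
          positivity
        linarith)
      have := (le_div_iff₀ ha0).2 (show a / 2 * a ≤ (w k).re by
        linarith [(pow_le_pow_iff_left₀ (by positivity) hx.le two_ne_zero).1 h])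
      simp only [hMre]
      linarith
    · intro b hb
      obtain ⟨c, hc⟩ : ∃ c, c = -ν - b := ⟨_, rfl⟩
      have hca : a / 2 < c := by linarith
      have hc0 : 0 < c := by linarith
      have hd : 0 < 4 * (a * c) ^ 2 - a ^ 4 := by
        have h1 : 0 < 2 * c - a := by linarith
        have h2 : 0 < a ^ 2 * ((2 * c - a) * (2 * c + a)) := by positivity
        linarith
      refine ⟨_,
        ⟨Real.sqrt (4 * a ^ 2 * ν ^ 2 * (a * c) ^ 2 / (4 * (a * c) ^ 2 - a ^ 4)), rfl⟩, ?_⟩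
      set k := Real.sqrt (4 * a ^ 2 * ν ^ 2 * (a * c) ^ 2 / (4 * (a * c) ^ 2 - a ^ 4)) with hk
      have hk2 : k ^ 2 * (4 * (a * c) ^ 2 - a ^ 4) = 4 * a ^ 2 * ν ^ 2 * (a * c) ^ 2 := by
        rw [hk, Real.sq_sqrt (by positivity), div_mul_cancel₀ _ hd.ne']
      obtain ⟨hx, hq⟩ := hquad_pos k
      have h := sq_lt_of_quadratic_pos hx (by positivity : 0 < (a * c) ^ 2) hq (by
        have : 0 < 4 * ((a * c) ^ 2) ^ 2 := by positivity
        linarith)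
      have := (div_lt_iff₀' ha0).2 (lt_of_pow_lt_pow_left₀ 2 (by positivity) h)
      simp only [hMre]
      linarith
end

section
/- Let ν > 1 and F > 2 be real. For k ∈ ℝ define w(k) = √( F²ν⁴ − i·F²ν²·k − k² ) (principal complex square root) and λ₊(k) = −ν + i·k·ν/(ν+1) + w(k)/(Fν). Then the supremum of the set {Re λ₊(k) : k ∈ ℝ} equals ν·(F/2 − 1) > 0; in particular there exists k ∈ ℝ with Re λ₊(k) > 0. -/
/-- The principal square root has nonnegative real part. -/
theorem re_cpow_half_nonneg (z : ℂ) : 0 ≤ (z ^ ((1 : ℂ) / 2)).re := by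
  rw [one_div, Complex.cpow_inv_two_re]
  exact Real.sqrt_nonneg _

/-- Eliminating the imaginary part `y` from `(x + i y)² = A - k² - 2 i M k`. -/
theorem re_cpow_half_quartic {A M k : ℝ} {z : ℂ} (hre : z.re = A - k ^ 2)
    (him : z.im = -(2 * M * k)) :
    k ^ 2 * (M ^ 2 - (z ^ ((1 : ℂ) / 2)).re ^ 2) =
      (z ^ ((1 : ℂ) / 2)).re ^ 2 * ((z ^ ((1 : ℂ) / 2)).re ^ 2 - A) := by
  have hsq : (z ^ ((1 : ℂ) / 2)) ^ 2 = z := by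
    rw [one_div]
    exact Complex.cpow_nat_inv_pow z two_ne_zero
  generalize z ^ ((1 : ℂ) / 2) = u at hsq ⊢
  have h₁ : u.re * u.re - u.im * u.im = A - k ^ 2 := by
    rw [← hre, ← hsq, pow_two, Complex.mul_re]
  have h₂ : u.re * u.im + u.im * u.re = -(2 * M * k) := by
    rw [← him, ← hsq, pow_two, Complex.mul_im]
  have h₃ : u.re * u.im = -(M * k) := by linarith
  linear_combination -u.re ^ 2 * h₁ - (u.re * u.im - M * k) * h₃

/-- A nonnegative solution `x` of `k² (M² - x²) = x² (x² - A)` with `A < M²` is below `M`. -/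
theorem lt_of_quartic {A M k x : ℝ} (hM : 0 < M) (hA : A < M ^ 2)
    (h : k ^ 2 * (M ^ 2 - x ^ 2) = x ^ 2 * (x ^ 2 - A)) : x < M := by
  by_contra! hx
  have hsq : M ^ 2 ≤ x ^ 2 := by gcongr
  have hleft : k ^ 2 * (M ^ 2 - x ^ 2) ≤ 0 :=
    mul_nonpos_of_nonneg_of_nonpos (sq_nonneg k) (by linarith)
  have hright : 0 < x ^ 2 * (x ^ 2 - A) :=
    mul_pos (pow_pos (hM.trans_le hx) 2) (by linarith)
  linarith

/-- Nonnegative solutions of `k² (M² - x²) = x² (x² - A)` come arbitrarily close to `M` for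
large `k`. -/
theorem exists_lt_of_quartic {A M c : ℝ} {x : ℝ → ℝ} (hA₀ : 0 ≤ A) (hM : 0 < M)
    (hc : c < M) (hx : ∀ k, 0 ≤ x k)
    (h : ∀ k, k ^ 2 * (M ^ 2 - x k ^ 2) = x k ^ 2 * (x k ^ 2 - A)) : ∃ k, c < x k := by
  by_contra! hle
  have hc₀ : 0 ≤ c := (hx 0).trans (hle 0)
  have hd : 0 < M ^ 2 - c ^ 2 := by
    have := pow_lt_pow_left₀ hc hc₀ two_ne_zero
    linarith
  set k := √((M ^ 4 + 1) / (M ^ 2 - c ^ 2)) with hk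
  have hk₂ : k ^ 2 * (M ^ 2 - c ^ 2) = M ^ 4 + 1 := by
    rw [hk, Real.sq_sqrt (by positivity)]
    field_simp
  have hxc : x k ^ 2 ≤ c ^ 2 := pow_le_pow_left₀ (hx k) (hle k) 2
  have hleft : k ^ 2 * (M ^ 2 - c ^ 2) ≤ k ^ 2 * (M ^ 2 - x k ^ 2) := by gcongr
  have hright : x k ^ 2 * (x k ^ 2 - A) ≤ M ^ 2 * M ^ 2 := by
    calc x k ^ 2 * (x k ^ 2 - A) ≤ x k ^ 2 * x k ^ 2 := by gcongr; linarith
      _ ≤ M ^ 2 * M ^ 2 := by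
        have : x k ^ 2 ≤ M ^ 2 := by linarith
        gcongr
  linarith [h k]

/-- For `ν > 1` and `F > 2`, with
`w(k) = √(F²ν⁴ − i F²ν² k − k²)` (principal complex square root) and
`λ₊(k) = −ν + i k ν/(ν+1) + w(k)/(Fν)`, the supremum of
`{Re λ₊(k) : k ∈ ℝ}` equals `ν (F/2 − 1) > 0`; in particular there exists `k`
with `Re λ₊(k) > 0`. -/
theorem stmt_4 (ν F : ℝ) (hν : 1 < ν) (hF : 2 < F)
    (w : ℝ → ℂ)
    (hw : ∀ k : ℝ, w k =
      (((F ^ 2 * ν ^ 4 : ℝ) : ℂ) - Complex.I * ((F ^ 2 * ν ^ 2 * k : ℝ) : ℂ) -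
        ((k ^ 2 : ℝ) : ℂ)) ^ ((1 : ℂ) / 2))
    (lamP : ℝ → ℂ)
    (hlamP : ∀ k : ℝ, lamP k =
      -(ν : ℂ) + Complex.I * ((k * ν / (ν + 1) : ℝ) : ℂ) + w k / ((F * ν : ℝ) : ℂ)) :
    sSup (Set.range fun k : ℝ => (lamP k).re) = ν * (F / 2 - 1) ∧
    0 < ν * (F / 2 - 1) ∧
    ∃ k : ℝ, 0 < (lamP k).re := by
  have hν₀ : 0 < ν := by linarith
  have hF₀ : 0 < F := by linarith
  have hM : 0 < F ^ 2 * ν ^ 2 / 2 := by positivity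
  have hA : F ^ 2 * ν ^ 4 < (F ^ 2 * ν ^ 2 / 2) ^ 2 := by
    have h₁ : 0 < F ^ 2 * ν ^ 4 * (F ^ 2 - 4) := mul_pos (by positivity) (by nlinarith)
    linarith
  have hw_nonneg (k : ℝ) : 0 ≤ (w k).re := hw k ▸ re_cpow_half_nonneg _
  have hquartic (k : ℝ) : k ^ 2 * ((F ^ 2 * ν ^ 2 / 2) ^ 2 - (w k).re ^ 2) =
      (w k).re ^ 2 * ((w k).re ^ 2 - F ^ 2 * ν ^ 4) := by
    rw [hw k]
    apply re_cpow_half_quartic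
    · simp only [Complex.sub_re, Complex.ofReal_re, Complex.I_mul_re, Complex.ofReal_im]
      ring
    · simp only [Complex.sub_im, Complex.ofReal_re, Complex.I_mul_im, Complex.ofReal_im]
      ring
  have hre (k : ℝ) : (lamP k).re = -ν + (w k).re / (F * ν) := by
    rw [hlamP k, Complex.add_re, Complex.add_re, Complex.div_ofReal_re, Complex.I_mul_re,
      Complex.ofReal_im, Complex.neg_re, Complex.ofReal_re]
    ring
  have hsup : ν * (F / 2 - 1) = -ν + F ^ 2 * ν ^ 2 / 2 / (F * ν) := by
    field_simp
    ring
  have hlt (k : ℝ) : (lamP k).re < ν * (F / 2 - 1) := by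
    rw [hre, hsup]
    gcongr
    exact lt_of_quartic hM hA (hquartic k)
  have hexists (c : ℝ) (hc : c < ν * (F / 2 - 1)) : ∃ k, c < (lamP k).re := by
    have hc' : (c + ν) * (F * ν) < F ^ 2 * ν ^ 2 / 2 := by
      rw [← lt_div_iff₀ (by positivity)]
      linarith
    obtain ⟨k, hk⟩ := exists_lt_of_quartic (by positivity) hM hc' hw_nonneg hquartic
    refine ⟨k, ?_⟩
    rw [← lt_div_iff₀ (by positivity)] at hk
    linarith [hre k]
  have hpos : 0 < ν * (F / 2 - 1) := mul_pos hν₀ (by linarith)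
  refine ⟨csSup_eq_of_forall_le_of_forall_lt_exists_gt (Set.range_nonempty _) ?_ ?_, hpos,
    hexists 0 hpos⟩
  · rintro _ ⟨k, rfl⟩
    exact (hlt k).le
  · intro c hc
    obtain ⟨k, hk⟩ := hexists c hc
    exact ⟨_, ⟨k, rfl⟩, hk⟩
end

section
/- Let ν > 1, 0 < F ≤ 2, and η ∈ ℝ with η ≠ 0. Then for every k ∈ ℝ: (4 − F²)·k⁶ + (4 − F²)·(F⁴ν⁴ + 6F²ν⁴ + 3η²)·k⁴ + ( η⁴·(9 − 2F²) + 9F⁴ν⁸·(4 − F²) + F²η²ν⁴·(60 − 13F²) )·k² + 2η²·(6F²ν⁴ + η²)² > 0. -/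
/-- For `ν > 1`, `0 < F ≤ 2`, and `η ≠ 0`, the stated sextic
polynomial in `k` (the resultant condition at the downstream endstate) is
strictly positive for every real `k`. -/
theorem stmt_5 (ν F η : ℝ) (hν : 1 < ν) (hF0 : 0 < F) (hF : F ≤ 2)
    (hη : η ≠ 0) (k : ℝ) :
    0 < (4 - F ^ 2) * k ^ 6
      + (4 - F ^ 2) * (F ^ 4 * ν ^ 4 + 6 * F ^ 2 * ν ^ 4 + 3 * η ^ 2) * k ^ 4
      + (η ^ 4 * (9 - 2 * F ^ 2) + 9 * F ^ 4 * ν ^ 8 * (4 - F ^ 2)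
          + F ^ 2 * η ^ 2 * ν ^ 4 * (60 - 13 * F ^ 2)) * k ^ 2
      + 2 * η ^ 2 * (6 * F ^ 2 * ν ^ 4 + η ^ 2) ^ 2 := by
  have hF2 : F ^ 2 ≤ 4 := by nlinarith
  have h4 : 0 ≤ 4 - F ^ 2 := by linarith
  have h9 : 0 ≤ 9 - 2 * F ^ 2 := by linarith
  have h60 : 0 ≤ 60 - 13 * F ^ 2 := by linarith
  have hν0 : 0 < ν := by linarith
  positivity
end

section
/- Let 0 < F ≤ 2 and η ∈ ℝ with η ≠ 0. Then for every k ∈ ℝ: (F² − 4)·k⁶ + (F² − 4)·(F⁴ + 6F² + 3η²)·k⁴ + ( 9F⁴·(F² − 4) + (13F² − 60)·F²·η² + (2F² − 9)·η⁴ )·k² − 2η²·(6F² + η²)² < 0. -/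
/-- For `0 < F ≤ 2` and `η ≠ 0`, the stated sextic polynomial
in `k` (the resultant condition at the upstream endstate) is strictly
negative for every real `k`. -/
theorem stmt_6 (F η : ℝ) (hF0 : 0 < F) (hF : F ≤ 2) (hη : η ≠ 0) (k : ℝ) :
    (F ^ 2 - 4) * k ^ 6
      + (F ^ 2 - 4) * (F ^ 4 + 6 * F ^ 2 + 3 * η ^ 2) * k ^ 4
      + (9 * F ^ 4 * (F ^ 2 - 4) + (13 * F ^ 2 - 60) * F ^ 2 * η ^ 2
          + (2 * F ^ 2 - 9) * η ^ 4) * k ^ 2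
      - 2 * η ^ 2 * (6 * F ^ 2 + η ^ 2) ^ 2 < 0 := by
  have hF2 : F ^ 2 - 4 ≤ 0 := by nlinarith
  have h_six : (F ^ 2 - 4) * k ^ 6 ≤ 0 :=
    mul_nonpos_of_nonpos_of_nonneg hF2 (by positivity)
  have h_four : (F ^ 2 - 4) * (F ^ 4 + 6 * F ^ 2 + 3 * η ^ 2) * k ^ 4 ≤ 0 :=
    mul_nonpos_of_nonpos_of_nonneg
      (mul_nonpos_of_nonpos_of_nonneg hF2 (by positivity)) (by positivity)
  have h_two : (9 * F ^ 4 * (F ^ 2 - 4) + (13 * F ^ 2 - 60) * F ^ 2 * η ^ 2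
      + (2 * F ^ 2 - 9) * η ^ 4) * k ^ 2 ≤ 0 := by
    refine mul_nonpos_of_nonpos_of_nonneg
      (add_nonpos (add_nonpos ?_ ?_) ?_) (by positivity)
    · exact mul_nonpos_of_nonneg_of_nonpos (by positivity) hF2
    · rw [mul_assoc]
      exact mul_nonpos_of_nonpos_of_nonneg (by linarith) (by positivity)
    · exact mul_nonpos_of_nonpos_of_nonneg (by linarith) (by positivity)
  have h_zero : 0 < 2 * η ^ 2 * (6 * F ^ 2 + η ^ 2) ^ 2 := by positivity
  linarith
end

section
/- Let ν > 1 and let F be real with 2 < F < F_2d(ν), where F_2d(ν) = ν(ν+1)/√(ν²+ν−1). Set F_e = ν(ν+1) and define the open interval I = ( F²/2 − F²/F_e − (F/F_2d)·√(F_2d² − F²), F²/2 − F²/F_e + (F/F_2d)·√(F_2d² − F²) ). Then: (i) I ⊆ (0, F_e); and (ii) for every μ ∈ I and every θ ∈ ℝ one has g₁(θ,μ) < 0, g₂(θ,μ) < 0 and g₃(θ,μ) < 0. -/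
/-- For `ν > 1` and `2 < F < F_2d(ν) = ν(ν+1)/√(ν²+ν−1)`, with
`F_e = ν(ν+1)` and the open interval
`I = (F²/2 − F²/F_e − (F/F_2d)√(F_2d² − F²), F²/2 − F²/F_e + (F/F_2d)√(F_2d² − F²))`:
(i) `I ⊆ (0, F_e)`, and (ii) for every `μ ∈ I` and every `θ ∈ ℝ` the three
leading-order weighted dispersion real parts `g₁, g₂, g₃` are negative. -/
theorem stmt_7 (ν F : ℝ) (hν : 1 < ν)
    (F2d Fe : ℝ)
    (hF2d : F2d = ν * (ν + 1) / Real.sqrt (ν ^ 2 + ν - 1))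
    (hFe : Fe = ν * (ν + 1))
    (hF2 : 2 < F) (hF : F < F2d)
    (lo hi : ℝ)
    (hlo : lo = F ^ 2 / 2 - F ^ 2 / Fe - (F / F2d) * Real.sqrt (F2d ^ 2 - F ^ 2))
    (hhi : hi = F ^ 2 / 2 - F ^ 2 / Fe + (F / F2d) * Real.sqrt (F2d ^ 2 - F ^ 2))
    (g1 g2 g3 : ℝ → ℝ → ℝ)
    (hg1 : ∀ θ μ : ℝ, g1 θ μ =
      (Real.cos θ * Fe + F) * μ / (F * Fe)
        - (Real.cos θ) ^ 2 / 2 - (F / 2) * Real.cos θ - 1 / 2)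
    (hg2 : ∀ θ μ : ℝ, g2 θ μ =
      -((Real.cos θ * Fe + F) * μ / (F * Fe))
        - (Real.cos θ) ^ 2 / 2 + (F / 2) * Real.cos θ - 1 / 2)
    (hg3 : ∀ θ μ : ℝ, g3 θ μ = μ / Fe - (Real.sin θ) ^ 2 - 1) :
    Set.Ioo lo hi ⊆ Set.Ioo 0 Fe ∧
    ∀ μ ∈ Set.Ioo lo hi, ∀ θ : ℝ, g1 θ μ < 0 ∧ g2 θ μ < 0 ∧ g3 θ μ < 0 := by
  have hFe2 : 2 < Fe := by rw [hFe]; nlinarith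
  have hFe0 : 0 < Fe := by linarith
  have hF0 : 0 < F := by linarith
  have hF2d0 : 0 < F2d := hF0.trans hF
  have hrad : ν ^ 2 + ν - 1 = Fe - 1 := by rw [hFe]; ring
  have hF2d_sq : F2d ^ 2 * (Fe - 1) = Fe ^ 2 := by
    rw [hrad, ← hFe] at hF2d
    have h1 : 0 < Fe - 1 := by linarith
    rw [hF2d, div_pow, Real.sq_sqrt h1.le, div_mul_cancel₀ _ h1.ne']
  have hradius : ((F / F2d) * Real.sqrt (F2d ^ 2 - F ^ 2)) ^ 2
      = F ^ 2 - F ^ 4 * (Fe - 1) / Fe ^ 2 := by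
    rw [mul_pow, Real.sq_sqrt (by nlinarith), ← hF2d_sq]
    have h1 : Fe - 1 ≠ 0 := by linarith
    field_simp
  have hquad : ∀ μ ∈ Set.Ioo lo hi, (μ / F - F / 2) ^ 2 < 1 - 2 * (μ / Fe) := by
    rintro μ ⟨hl, hh⟩
    have hprod : (μ - (F ^ 2 / 2 - F ^ 2 / Fe)) ^ 2
        < F ^ 2 - F ^ 4 * (Fe - 1) / Fe ^ 2 := by
      rw [← hradius]
      exact sq_lt_sq' (by linarith) (by linarith)
    have hid : F ^ 2 * (1 - 2 * (μ / Fe) - (μ / F - F / 2) ^ 2)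
        = F ^ 2 - F ^ 4 * (Fe - 1) / Fe ^ 2 - (μ - (F ^ 2 / 2 - F ^ 2 / Fe)) ^ 2 := by
      field_simp
      ring
    have hpos : 0 < F ^ 2 * (1 - 2 * (μ / Fe) - (μ / F - F / 2) ^ 2) := by linarith
    linarith [pos_of_mul_pos_right hpos (sq_nonneg F)]
  have hsub : Set.Ioo lo hi ⊆ Set.Ioo 0 Fe := by
    intro μ hμ
    have hq := hquad μ hμ
    constructor
    · by_contra! h
      have hinv : 2 / Fe < 1 := (div_lt_one hFe0).2 hFe2
      have hexp : (μ / F - F / 2) ^ 2 = (μ / F) ^ 2 - μ + F ^ 2 / 4 := by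
        field_simp
        ring
      have hdiv : 2 * (μ / Fe) = μ * (2 / Fe) := by ring
      nlinarith [sq_nonneg (μ / F)]
    · rw [← div_lt_one hFe0]
      linarith [sq_nonneg (μ / F - F / 2)]
  refine ⟨hsub, fun μ hμ θ ↦ ?_⟩
  have hq := hquad μ hμ
  have hμ0 : 0 < μ / Fe := div_pos (hsub hμ).1 hFe0
  have hμ1 : μ / Fe < 1 := (div_lt_one hFe0).2 (hsub hμ).2
  have hsplit : (Real.cos θ * Fe + F) * μ / (F * Fe) = Real.cos θ * (μ / F) + μ / Fe := by
    field_simp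
  refine ⟨?_, ?_, ?_⟩
  · rw [hg1, hsplit]
    nlinarith [sq_nonneg (Real.cos θ - (μ / F - F / 2))]
  · rw [hg2, hsplit]
    nlinarith [sq_nonneg (Real.cos θ + (μ / F - F / 2))]
  · rw [hg3]
    linarith [sq_nonneg (Real.sin θ)]
end

section
/- Let ν > 1 and let F be real with F_2d(ν) < F < F_e, where F_e = ν(ν+1) and F_2d(ν) = ν(ν+1)/√(ν²+ν−1). Then for every μ ∈ ℝ there exists θ ∈ ℝ (namely any θ with cos θ = −F/F_e) such that g₁(θ,μ) = ( F²·(F_e − 1) − F_e² )/(2F_e²) > 0. In particular no exponential weight μ ≥ 0 makes g₁(θ,μ) ≤ 0 for all θ ∈ ℝ. -/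
/-- For `ν > 1` and `F_2d(ν) < F < F_e = ν(ν+1)`, for every
`μ ∈ ℝ` there exists `θ` (namely any `θ` with `cos θ = −F/F_e`) such that
`g₁(θ,μ) = (F²(F_e − 1) − F_e²)/(2F_e²) > 0`. In particular no exponential
weight `μ ≥ 0` makes `g₁(θ,μ) ≤ 0` for all `θ`. -/
theorem stmt_8 (ν F : ℝ) (hν : 1 < ν)
    (F2d Fe : ℝ)
    (hF2d : F2d = ν * (ν + 1) / Real.sqrt (ν ^ 2 + ν - 1))
    (hFe : Fe = ν * (ν + 1))
    (hFl : F2d < F) (hFu : F < Fe)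
    (g1 : ℝ → ℝ → ℝ)
    (hg1 : ∀ θ μ : ℝ, g1 θ μ =
      (Real.cos θ * Fe + F) * μ / (F * Fe)
        - (Real.cos θ) ^ 2 / 2 - (F / 2) * Real.cos θ - 1 / 2) :
    (∀ μ : ℝ, ∃ θ : ℝ, Real.cos θ = -F / Fe ∧
      g1 θ μ = (F ^ 2 * (Fe - 1) - Fe ^ 2) / (2 * Fe ^ 2) ∧
      0 < (F ^ 2 * (Fe - 1) - Fe ^ 2) / (2 * Fe ^ 2)) ∧
    ¬ ∃ μ : ℝ, 0 ≤ μ ∧ ∀ θ : ℝ, g1 θ μ ≤ 0 := by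
  have hFe2 : 2 < Fe := by rw [hFe]; nlinarith
  have hFe0 : 0 < Fe := by linarith
  have hs : ν ^ 2 + ν - 1 = Fe - 1 := by rw [hFe]; ring
  have hs0 : 0 < Real.sqrt (Fe - 1) := Real.sqrt_pos.mpr (by linarith)
  rw [hF2d, hs, ← hFe] at hFl
  have hF0 : 0 < F := (div_pos hFe0 hs0).trans hFl
  have hsq : Fe ^ 2 < F ^ 2 * (Fe - 1) := by
    have h : Fe ^ 2 < (F * Real.sqrt (Fe - 1)) ^ 2 :=
      pow_lt_pow_left₀ ((div_lt_iff₀ hs0).mp hFl) hFe0.le two_ne_zero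
    rwa [mul_pow, Real.sq_sqrt (by linarith)] at h
  have hpos : 0 < (F ^ 2 * (Fe - 1) - Fe ^ 2) / (2 * Fe ^ 2) :=
    div_pos (sub_pos.mpr hsq) (by positivity)
  have hcos : Real.cos (Real.arccos (-F / Fe)) = -F / Fe := by
    apply Real.cos_arccos
    · rw [le_div_iff₀ hFe0]; linarith
    · rw [div_le_iff₀ hFe0]; linarith
  have hval (μ : ℝ) : g1 (Real.arccos (-F / Fe)) μ =
      (F ^ 2 * (Fe - 1) - Fe ^ 2) / (2 * Fe ^ 2) := by
    rw [hg1, hcos, div_mul_cancel₀ _ hFe0.ne', neg_add_cancel]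
    field_simp
    ring
  refine ⟨fun μ => ⟨_, hcos, hval μ, hpos⟩, ?_⟩
  rintro ⟨μ, -, h⟩
  exact absurd (h _) (not_le.mpr ((hval μ).symm ▸ hpos))
end

section
/- Let ν > 1 and let F be real with 2 < F < F_2d(ν), where F_2d(ν) = ν(ν+1)/√(ν²+ν−1). Set F_e = ν(ν+1) and μ* = F²/2 − F²/F_e. Then for every θ ∈ ℝ: g₁(θ,μ*) ≤ (F² − F_2d²)/(2F_2d²) < 0, g₂(θ,μ*) ≤ (F² − F_2d²)/(2F_2d²) < 0, and g₃(θ,μ*) ≤ F²·(F_e − 2)/(2F_e²) − 1 < 0. -/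
/-- For `ν > 1` and `2 < F < F_2d(ν)`, with `F_e = ν(ν+1)` and
the optimal weight `μ* = F²/2 − F²/F_e`, for every `θ ∈ ℝ`:
`g₁(θ,μ*) ≤ (F² − F_2d²)/(2F_2d²) < 0`,
`g₂(θ,μ*) ≤ (F² − F_2d²)/(2F_2d²) < 0`, and
`g₃(θ,μ*) ≤ F²(F_e − 2)/(2F_e²) − 1 < 0`. -/
theorem stmt_9 (ν F : ℝ) (hν : 1 < ν)
    (F2d Fe : ℝ)
    (hF2d : F2d = ν * (ν + 1) / Real.sqrt (ν ^ 2 + ν - 1))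
    (hFe : Fe = ν * (ν + 1))
    (hF2 : 2 < F) (hF : F < F2d)
    (μs : ℝ) (hμs : μs = F ^ 2 / 2 - F ^ 2 / Fe)
    (g1 g2 g3 : ℝ → ℝ → ℝ)
    (hg1 : ∀ θ μ : ℝ, g1 θ μ =
      (Real.cos θ * Fe + F) * μ / (F * Fe)
        - (Real.cos θ) ^ 2 / 2 - (F / 2) * Real.cos θ - 1 / 2)
    (hg2 : ∀ θ μ : ℝ, g2 θ μ =
      -((Real.cos θ * Fe + F) * μ / (F * Fe))
        - (Real.cos θ) ^ 2 / 2 + (F / 2) * Real.cos θ - 1 / 2)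
    (hg3 : ∀ θ μ : ℝ, g3 θ μ = μ / Fe - (Real.sin θ) ^ 2 - 1) :
    ∀ θ : ℝ,
      (g1 θ μs ≤ (F ^ 2 - F2d ^ 2) / (2 * F2d ^ 2) ∧
        (F ^ 2 - F2d ^ 2) / (2 * F2d ^ 2) < 0) ∧
      (g2 θ μs ≤ (F ^ 2 - F2d ^ 2) / (2 * F2d ^ 2) ∧
        (F ^ 2 - F2d ^ 2) / (2 * F2d ^ 2) < 0) ∧
      (g3 θ μs ≤ F ^ 2 * (Fe - 2) / (2 * Fe ^ 2) - 1 ∧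
        F ^ 2 * (Fe - 2) / (2 * Fe ^ 2) - 1 < 0) := by
  have hE : 2 < Fe := by rw [hFe]; nlinarith
  have hE0 : Fe ≠ 0 := by positivity
  have hF0 : F ≠ 0 := by positivity
  have hE1 : 0 < Fe - 1 := by linarith
  have hsq : F2d ^ 2 = Fe ^ 2 / (Fe - 1) := by
    have h : ν ^ 2 + ν - 1 = Fe - 1 := by rw [hFe]; ring
    rw [hF2d, h, ← hFe, div_pow, Real.sq_sqrt hE1.le]
  have hlt : F ^ 2 < F2d ^ 2 := by gcongr
  have hF2d0 : 0 < F2d := by linarith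
  have hneg : (F ^ 2 - F2d ^ 2) / (2 * F2d ^ 2) < 0 :=
    div_neg_of_neg_of_pos (by linarith) (by positivity)
  obtain ⟨k, hk⟩ : ∃ k, k = F / Fe := ⟨_, rfl⟩
  have hFk : F = k * Fe := by rw [hk]; field_simp
  have hk0 : k ≠ 0 := fun h => hF0 (by rw [hFk, h, zero_mul])
  have hμk : μs = k ^ 2 * Fe * (Fe - 2) / 2 := by
    rw [hμs, hFk]; field_simp
  have hbound : (F ^ 2 - F2d ^ 2) / (2 * F2d ^ 2) = k ^ 2 * (Fe - 1) / 2 - 1 / 2 := by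
    rw [hsq, hFk]; field_simp
  have hkE : k ^ 2 * (Fe - 1) < 1 := by
    rw [hbound] at hneg; linarith
  have hbound3 : F ^ 2 * (Fe - 2) / (2 * Fe ^ 2) - 1 = k ^ 2 * (Fe - 2) / 2 - 1 := by
    rw [hFk]; field_simp
  intro θ
  refine ⟨⟨?_, hneg⟩, ⟨?_, hneg⟩, ?_, ?_⟩
  · have h : g1 θ μs = -(Real.cos θ + k) ^ 2 / 2 + (k ^ 2 * (Fe - 1) / 2 - 1 / 2) := by
      rw [hg1, hμk, hFk]; field_simp; ring
    rw [h, hbound]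
    linarith [sq_nonneg (Real.cos θ + k)]
  · have h : g2 θ μs =
        -(Real.cos θ - k) ^ 2 / 2 - k ^ 2 * (Fe - 2) + (k ^ 2 * (Fe - 1) / 2 - 1 / 2) := by
      rw [hg2, hμk, hFk]; field_simp; ring
    rw [h, hbound]
    linarith [sq_nonneg (Real.cos θ - k), mul_nonneg (sq_nonneg k) (sub_nonneg.2 hE.le)]
  · have h : g3 θ μs = k ^ 2 * (Fe - 2) / 2 - Real.sin θ ^ 2 - 1 := by
      rw [hg3, hμk]; field_simp
    rw [h, hbound3]
    linarith [sq_nonneg (Real.sin θ)]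
  · rw [hbound3]
    linarith [sq_nonneg k]
end

section
/- For every real ν > 1 the following strict chain of inequalities holds: (ν+1)/ν² < 2 < ν(ν+1)/√(ν²+ν−1) < √(2ν(ν+1)) < ν(ν+1). That is, F_char(ν) < 2 < F_2d(ν) < F_1d(ν) < F_exist(ν). -/
/-- For every real `ν > 1`,
`F_char(ν) < 2 < F_2d(ν) < F_1d(ν) < F_exist(ν)`, i.e.
`(ν+1)/ν² < 2 < ν(ν+1)/√(ν²+ν−1) < √(2ν(ν+1)) < ν(ν+1)`. -/
theorem stmt_10 (ν : ℝ) (hν : 1 < ν) :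
    (ν + 1) / ν ^ 2 < 2 ∧
    2 < ν * (ν + 1) / Real.sqrt (ν ^ 2 + ν - 1) ∧
    ν * (ν + 1) / Real.sqrt (ν ^ 2 + ν - 1) < Real.sqrt (2 * ν * (ν + 1)) ∧
    Real.sqrt (2 * ν * (ν + 1)) < ν * (ν + 1) := by
  have hp : 2 < ν * (ν + 1) := by nlinarith
  have hq : ν ^ 2 + ν - 1 = ν * (ν + 1) - 1 := by ring
  have hr : 2 * ν * (ν + 1) = 2 * (ν * (ν + 1)) := by ring
  have hchar : (ν + 1) / ν ^ 2 < 2 := by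
    rw [div_lt_iff₀ (by positivity)]
    nlinarith
  rw [hq, hr]
  generalize ν * (ν + 1) = p at hp ⊢
  have hs : 0 < Real.sqrt (p - 1) := Real.sqrt_pos.mpr (by linarith)
  refine ⟨hchar, ?_, ?_, ?_⟩
  · rw [lt_div_iff₀ hs]
    have h : Real.sqrt (p - 1) < p / 2 :=
      (Real.sqrt_lt' (by linarith)).mpr (by nlinarith)
    linarith
  · rw [div_lt_iff₀ hs, ← Real.sqrt_mul (by linarith)]
    exact Real.lt_sqrt_of_sq_lt (by nlinarith)
  · exact (Real.sqrt_lt' (by linarith)).mpr (by nlinarith)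
end

section
/- Let ν > 1 and let F be real with 0 < F ≤ √(2ν(ν+1)). Setting F_e = ν(ν+1), one has: (−F_e³ − 9F_e² + 27F_e − 27)·F⁶ + 3F_e²·(5F_e² − 6F_e + 9)·F⁴ − 3F_e⁴·(7F_e + 3)·F² + 17F_e⁶ > 0. -/
/-- For `ν > 1` and `0 < F ≤ √(2ν(ν+1))`, with `F_e = ν(ν+1)`,
the cubic-in-`F²` quantity `#(F,ν)` is strictly positive:
`(−F_e³ − 9F_e² + 27F_e − 27)F⁶ + 3F_e²(5F_e² − 6F_e + 9)F⁴
  − 3F_e⁴(7F_e + 3)F² + 17F_e⁶ > 0`. -/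
theorem stmt_11 (ν F : ℝ) (hν : 1 < ν) (hF0 : 0 < F)
    (hF : F ≤ Real.sqrt (2 * ν * (ν + 1)))
    (Fe : ℝ) (hFe : Fe = ν * (ν + 1)) :
    0 < (-Fe ^ 3 - 9 * Fe ^ 2 + 27 * Fe - 27) * F ^ 6
      + 3 * Fe ^ 2 * (5 * Fe ^ 2 - 6 * Fe + 9) * F ^ 4
      - 3 * Fe ^ 4 * (7 * Fe + 3) * F ^ 2
      + 17 * Fe ^ 6 := by
  have hFe2 : 2 < Fe := by nlinarith
  have hF2 : F ^ 2 ≤ 2 * Fe := by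
    have h := (Real.le_sqrt' hF0).1 hF
    linarith
  have hpos : 0 < Fe * F ^ 2 + Fe ^ 2 - 3 * F ^ 2 := by nlinarith [sq_nonneg F]
  have hnonneg : 0 ≤ 2 * Fe - F ^ 2 := sub_nonneg.2 hF2
  calc
    0 < (Fe * F ^ 2 + Fe ^ 2 - 3 * F ^ 2) ^ 3 + 2 * Fe ^ 3 * (2 * Fe - F ^ 2) ^ 3 := by
      positivity
    _ = _ := by ring
end

section
/- Let 0 < H_R < 1 be real. Then the quadratic polynomial q(X) = 2·(H_R + √H_R − 3)²·X² − H_R·(√H_R + 1)²·(5H_R + 5√H_R − 6)·X + 2·H_R²·(√H_R + 1)⁴ has no real root; indeed its discriminant equals 9·H_R²·(√H_R + 1)⁴·(√H_R − 1)·(√H_R + 2)·(H_R + √H_R + 6), which is negative for 0 < H_R < 1. -/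
/-- For `0 < H_R < 1`, the quadratic
`q(X) = 2(H_R + √H_R − 3)² X² − H_R(√H_R + 1)²(5H_R + 5√H_R − 6) X + 2H_R²(√H_R + 1)⁴`
has no real root; indeed its discriminant equals
`9 H_R² (√H_R + 1)⁴ (√H_R − 1)(√H_R + 2)(H_R + √H_R + 6)`, which is negative. -/
theorem stmt_12 (HR : ℝ) (h0 : 0 < HR) (h1 : HR < 1)
    (A B C : ℝ)
    (hA : A = 2 * (HR + Real.sqrt HR - 3) ^ 2)
    (hB : B = -(HR * (Real.sqrt HR + 1) ^ 2 * (5 * HR + 5 * Real.sqrt HR - 6)))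
    (hC : C = 2 * HR ^ 2 * (Real.sqrt HR + 1) ^ 4) :
    B ^ 2 - 4 * A * C =
      9 * HR ^ 2 * (Real.sqrt HR + 1) ^ 4 * (Real.sqrt HR - 1) * (Real.sqrt HR + 2)
        * (HR + Real.sqrt HR + 6) ∧
    B ^ 2 - 4 * A * C < 0 ∧
    ∀ X : ℝ, A * X ^ 2 + B * X + C ≠ 0 := by
  have hs0 : 0 < √HR := Real.sqrt_pos.2 h0
  have hs1 : √HR < 1 := (Real.sqrt_lt' one_pos).2 (by simpa using h1)
  have hsq : √HR ^ 2 = HR := Real.sq_sqrt h0.le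
  have hdisc : B ^ 2 - 4 * A * C =
      9 * HR ^ 2 * (√HR + 1) ^ 4 * (√HR - 1) * (√HR + 2) * (HR + √HR + 6) := by
    subst hA hB hC
    linear_combination (-9) * HR ^ 2 * (√HR + 1) ^ 4 * (HR + √HR + 6) * hsq
  have hneg : B ^ 2 - 4 * A * C < 0 := by
    rw [hdisc]
    exact mul_neg_of_neg_of_pos (mul_neg_of_neg_of_pos
      (mul_neg_of_pos_of_neg (by positivity) (sub_neg.2 hs1)) (by positivity)) (by positivity)
  refine ⟨hdisc, hneg, fun X hX ↦ hneg.not_ge ?_⟩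
  have hsquare : B ^ 2 - 4 * A * C = (2 * A * X + B) ^ 2 := by
    linear_combination (-4) * A * hX
  exact hsquare ▸ sq_nonneg _
end

section
/- Let 0 < H_R < 1 and let F be real with F ≥ H_R + √H_R. Then there is no real number H_* satisfying simultaneously 3·(√H_R + 1)²·H_*² − F²·H_R·(H_R + √H_R + 1) = 0 and (√H_R + 1)²·H_*² + H_R·(√H_R + 1)²·H_* − 2F²·H_R = 0. -/
/-- For `0 < H_R < 1` and real `F ≥ H_R + √H_R`, there is no
real `H_*` satisfying simultaneously
`3(√H_R + 1)² H_*² − F² H_R (H_R + √H_R + 1) = 0` and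
`(√H_R + 1)² H_*² + H_R (√H_R + 1)² H_* − 2F² H_R = 0`. -/
theorem stmt_13 (HR F : ℝ) (h0 : 0 < HR) (h1 : HR < 1)
    (hF : HR + Real.sqrt HR ≤ F) :
    ¬ ∃ Hs : ℝ,
      3 * (Real.sqrt HR + 1) ^ 2 * Hs ^ 2 - F ^ 2 * HR * (HR + Real.sqrt HR + 1) = 0 ∧
      (Real.sqrt HR + 1) ^ 2 * Hs ^ 2 + HR * (Real.sqrt HR + 1) ^ 2 * Hs
        - 2 * F ^ 2 * HR = 0 := by
  rintro ⟨H, e1, e2⟩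
  obtain ⟨s, hs, hs0⟩ : ∃ s, s = Real.sqrt HR ∧ 0 < s := ⟨_, rfl, Real.sqrt_pos.2 h0⟩
  have hHR : HR = s ^ 2 := by rw [hs, Real.sq_sqrt h0.le]
  rw [← hs] at hF e1 e2
  subst hHR
  have hs1 : s < 1 := by nlinarith
  obtain ⟨q, hq⟩ : ∃ q, q = s ^ 2 + s + 1 := ⟨_, rfl⟩
  have hq0 : 0 < q := by rw [hq]; positivity
  have hq3 : q < 3 := by linarith
  rw [← hq] at e1
  have ha : 0 < (s + 1) ^ 2 := by positivity
  have hF2 : s ^ 2 * (s + 1) ^ 2 ≤ F ^ 2 := by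
    have := pow_le_pow_left₀ (by positivity) hF 2
    linarith [show (s ^ 2 + s) ^ 2 = s ^ 2 * (s + 1) ^ 2 by ring]
  have hlow : s ^ 4 * q ≤ 3 * H ^ 2 := by
    refine le_of_mul_le_mul_left ?_ ha
    linarith [mul_le_mul_of_nonneg_right hF2 (show 0 ≤ s ^ 2 * q by positivity)]
  have hH : H ≠ 0 := by
    rintro rfl
    have : 0 < s ^ 4 * q := by positivity
    linarith
  have hlin : (6 - q) * H = q * s ^ 2 := by
    refine mul_left_cancel₀ (mul_ne_zero ha.ne' hH) ?_
    linear_combination 2 * e1 - q * e2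
  have hpoly : (6 - q) ^ 2 ≤ 3 * q := by
    refine le_of_mul_le_mul_left ?_ (show 0 < s ^ 4 * q by positivity)
    have hsq : (6 - q) ^ 2 * H ^ 2 = q ^ 2 * s ^ 4 := by
      linear_combination ((6 - q) * H + q * s ^ 2) * hlin
    linarith [mul_le_mul_of_nonneg_left hlow (sq_nonneg (6 - q))]
  nlinarith [mul_pos (sub_pos.2 hq3) (show 0 < 12 - q by linarith)]
end

section
/- Let 0 < H_R < 1 and let F be real with 0 < F ≤ 2. Then there is no real number H_* satisfying simultaneously (√H_R + 1)²·H_*³ − F²·H_R·(H_R + √H_R + 1)·H_* + 2F²·H_R² = 0 and (√H_R + 1)²·H_*² + H_R·(√H_R + 1)²·H_* − 2F²·H_R = 0. -/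
/-- For `0 < H_R < 1` and real `0 < F ≤ 2`, there is no real
`H_*` satisfying simultaneously
`(√H_R + 1)² H_*³ − F² H_R (H_R + √H_R + 1) H_* + 2F² H_R² = 0` and
`(√H_R + 1)² H_*² + H_R (√H_R + 1)² H_* − 2F² H_R = 0`. -/
theorem stmt_14 (HR F : ℝ) (h0 : 0 < HR) (h1 : HR < 1)
    (hF0 : 0 < F) (hF : F ≤ 2) :
    ¬ ∃ Hs : ℝ,
      (Real.sqrt HR + 1) ^ 2 * Hs ^ 3
        - F ^ 2 * HR * (HR + Real.sqrt HR + 1) * Hs + 2 * F ^ 2 * HR ^ 2 = 0 ∧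
      (Real.sqrt HR + 1) ^ 2 * Hs ^ 2 + HR * (Real.sqrt HR + 1) ^ 2 * Hs
        - 2 * F ^ 2 * HR = 0 := by
  rintro ⟨h, e1, e2⟩
  obtain ⟨s, hs⟩ : ∃ s, s = Real.sqrt HR := ⟨_, rfl⟩
  have hs0 : 0 < s := hs ▸ Real.sqrt_pos.mpr h0
  have hsq : HR = s ^ 2 := by rw [hs, Real.sq_sqrt h0.le]
  rw [← hs] at e1 e2
  subst hsq
  have hs1 : s < 1 := by nlinarith
  have hh : h ≠ 0 := by
    rintro rfl
    have : 0 < 2 * F ^ 2 * s ^ 2 := by positivity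
    linarith
  have key : (s ^ 2 * h) * ((s ^ 2 + s) ^ 2 - F ^ 2 * (s ^ 2 + s - 1)) = 0 := by
    linear_combination e1 - (h - s ^ 2) * e2
  have key' : (s ^ 2 + s) ^ 2 - F ^ 2 * (s ^ 2 + s - 1) = 0 :=
    (mul_eq_zero.mp key).resolve_left (mul_ne_zero (by positivity) hh)
  have hy : 0 < s ^ 2 + s - 1 := by
    have : 0 < F ^ 2 * (s ^ 2 + s - 1) := by
      have : 0 < (s ^ 2 + s) ^ 2 := by positivity
      linarith
    exact pos_of_mul_pos_right this (sq_nonneg F)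
  have hF4 : F ^ 2 ≤ 4 := by nlinarith
  have hy2 : 0 < (2 - (s ^ 2 + s)) ^ 2 := pow_pos (by nlinarith) 2
  nlinarith [mul_le_mul_of_nonneg_right hF4 hy.le]
end

section
/- Let 0 < H_R < 1, let F be real with √H_R + H_R < F ≤ 2, set F_e = (1 + √H_R)/H_R, and let H_* > 0 satisfy the Rankine–Hugoniot relation (√H_R + 1)²·H_*² + H_R·(√H_R + 1)²·H_* = 2F²·H_R. Then for every real H ≥ H_*: (i) 2·F_e²·H³ − F²·(F_e + 1)·H + F² > 0, and (ii) F_e²·H³ − F²·(F_e + 1)·H + 2F² > 0. -/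
/-- For `0 < H_R < 1`, `√H_R + H_R < F ≤ 2`,
`F_e = (1 + √H_R)/H_R`, and a subshock height `H_* > 0` satisfying the
Rankine–Hugoniot relation
`(√H_R + 1)² H_*² + H_R (√H_R + 1)² H_* = 2F² H_R`, one has for every
`H ≥ H_*`: (i) `2F_e² H³ − F²(F_e + 1) H + F² > 0` and
(ii) `F_e² H³ − F²(F_e + 1) H + 2F² > 0`. -/
theorem stmt_15 (HR F : ℝ) (h0 : 0 < HR) (h1 : HR < 1)
    (hFl : Real.sqrt HR + HR < F) (hFu : F ≤ 2)
    (Fe : ℝ) (hFe : Fe = (1 + Real.sqrt HR) / HR)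
    (Hs : ℝ) (hHs : 0 < Hs)
    (hRH : (Real.sqrt HR + 1) ^ 2 * Hs ^ 2
      + HR * (Real.sqrt HR + 1) ^ 2 * Hs = 2 * F ^ 2 * HR) :
    ∀ H : ℝ, Hs ≤ H →
      0 < 2 * Fe ^ 2 * H ^ 3 - F ^ 2 * (Fe + 1) * H + F ^ 2 ∧
      0 < Fe ^ 2 * H ^ 3 - F ^ 2 * (Fe + 1) * H + 2 * F ^ 2 := by
  intro H hH
  obtain ⟨s, hs, rfl⟩ : ∃ s : ℝ, 0 < s ∧ HR = s ^ 2 :=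
    ⟨√HR, Real.sqrt_pos.2 h0, (Real.sq_sqrt h0.le).symm⟩
  rw [Real.sqrt_sq hs.le] at hFl hFe hRH
  have hs1 : s < 1 := by nlinarith
  obtain ⟨K, hK⟩ : ∃ K, K = Hs * (Hs + s ^ 2) := ⟨_, rfl⟩
  have hF2 : F ^ 2 = (s + 1) ^ 2 * K / (2 * s ^ 2) := by
    rw [eq_div_iff (by positivity), hK]
    linarith
  have hKpos : 0 < K := by rw [hK]; positivity
  have hu : s + s ^ 2 < 2 := by nlinarith
  have hKl : 2 * s ^ 4 < K := by
    have h : (s + s ^ 2) ^ 2 < F ^ 2 := by gcongr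
    rw [hF2, lt_div_iff₀ (by positivity)] at h
    have hp : 0 < (s + 1) ^ 2 := by positivity
    refine lt_of_mul_lt_mul_left ?_ hp.le
    linarith
  have hKu : (s + 1) ^ 2 * K ≤ 8 * s ^ 2 := by
    have hF0 : 0 ≤ F := by nlinarith
    have h : F ^ 2 ≤ 2 ^ 2 := by gcongr
    rw [hF2, div_le_iff₀ (by positivity)] at h
    linarith
  have hsh : s ^ 2 < Hs := by
    by_contra! hc
    nlinarith [mul_le_mul hc hc hHs.le (sq_nonneg s)]
  have hslope : K * (1 + s + s ^ 2) ≤ 6 * Hs ^ 2 := by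
    have h : K ≤ 2 * Hs ^ 2 := by nlinarith
    calc K * (1 + s + s ^ 2) ≤ (2 * Hs ^ 2) * 3 := by gcongr; linarith
      _ = 6 * Hs ^ 2 := by ring
  have hcube : 3 * Hs ^ 2 * (H - Hs) ≤ H ^ 3 - Hs ^ 3 := by
    nlinarith [mul_nonneg (sq_nonneg (H - Hs)) (by linarith : 0 ≤ H + 2 * Hs)]
  have hmul := mul_le_mul_of_nonneg_right hslope (sub_nonneg.2 hH)
  have hsq : 0 ≤ Hs ^ 2 * (H - Hs) := mul_nonneg (sq_nonneg _) (sub_nonneg.2 hH)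
  have base₁ : 0 < 4 * Hs ^ 3 - K * ((1 + s + s ^ 2) * Hs - s ^ 2) := by
    have e : 4 * Hs ^ 3 - K * ((1 + s + s ^ 2) * Hs - s ^ 2) =
        Hs * ((Hs - s ^ 2) ^ 2 + (2 - (s + s ^ 2)) * (Hs * (Hs + s ^ 2))) := by
      rw [hK]; ring
    have hd : 0 < 2 - (s + s ^ 2) := sub_pos.2 hu
    rw [e]; positivity
  have base₂ : 0 < 2 * Hs ^ 3 - K * ((1 + s + s ^ 2) * Hs - 2 * s ^ 2) := by
    have e : 2 * Hs ^ 3 - K * ((1 + s + s ^ 2) * Hs - 2 * s ^ 2) =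
        Hs * ((1 - s - s ^ 2) * K + 2 * s ^ 4) := by
      rw [hK]; ring
    rw [e]
    refine mul_pos hHs ?_
    rcases le_total 0 (1 - s - s ^ 2) with h | h
    · positivity
    · have h₁ := mul_le_mul_of_nonpos_left hKu h
      have h₂ : 0 < 2 * s ^ 2 * (2 - (s + s ^ 2)) ^ 2 := by
        have hd : 0 < 2 - (s + s ^ 2) := sub_pos.2 hu
        positivity
      have hp : 0 < (s + 1) ^ 2 := by positivity
      refine pos_of_mul_pos_right (a := (s + 1) ^ 2) ?_ hp.le
      nlinarith
  have cubic₁ : 0 < 4 * H ^ 3 - K * ((1 + s + s ^ 2) * H - s ^ 2) := by linarith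
  have cubic₂ : 0 < 2 * H ^ 3 - K * ((1 + s + s ^ 2) * H - 2 * s ^ 2) := by linarith
  have hc : 0 < (s + 1) ^ 2 / (2 * s ^ 4) := by positivity
  constructor
  · refine (mul_pos hc cubic₁).trans_eq ?_
    rw [hF2, hFe]
    field_simp
    ring
  · refine (mul_pos hc cubic₂).trans_eq ?_
    rw [hF2, hFe]
    field_simp
    ring
end
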